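/- Covariance moment matching (part of Theorem 1): with A := Σ_post Σ₁⁻¹ and Σ_anc := Σ₁ + Σ₁ Σ₂⁻¹ Σ₁, one has A Σ_anc Aᵀ = Σ_post, i.e. the covariance of the affine MAP map applied to a random vector with covariance Σ_anc equals the posterior covariance Σ_post. -/

import Mathlib

open Matrix

/-- Covariance moment matching: with `A := Σ_post S1⁻¹`,
`Σ_anc := S1 + S1 S2⁻¹ S1`, and `Σ_post := (S1⁻¹ + S2⁻¹)⁻¹`, we have
`A Σ_anc Aᵀ = Σ_post`. -/
theorem stmt_5 (d : ℕ) (hd : 1 ≤ d) (S1 S2 : Matrix (Fin d) (Fin d) ℝ)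
    (hS1sym : S1.IsSymm) (hS1 : S1.PosDef)
    (hS2sym : S2.IsSymm) (hS2 : S2.PosDef) :
    ((S1⁻¹ + S2⁻¹)⁻¹ * S1⁻¹) * (S1 + S1 * S2⁻¹ * S1) * ((S1⁻¹ + S2⁻¹)⁻¹ * S1⁻¹)ᵀ
      = (S1⁻¹ + S2⁻¹)⁻¹ := by
  have h1 : IsUnit S1.det := (Matrix.isUnit_iff_isUnit_det _).1 hS1.isUnit
  have hP : IsUnit (S1⁻¹ + S2⁻¹).det :=
    (Matrix.isUnit_iff_isUnit_det _).1 (hS1.inv.add hS2.inv).isUnit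
  have hT : ((S1⁻¹ + S2⁻¹)⁻¹ * S1⁻¹)ᵀ = S1⁻¹ * (S1⁻¹ + S2⁻¹)⁻¹ := by
    rw [Matrix.transpose_mul, Matrix.transpose_nonsing_inv, Matrix.transpose_nonsing_inv,
      Matrix.transpose_add, Matrix.transpose_nonsing_inv, Matrix.transpose_nonsing_inv,
      hS1sym.eq, hS2sym.eq]
  have hK : S1⁻¹ * (S1 + S1 * S2⁻¹ * S1) = (S1⁻¹ + S2⁻¹) * S1 := by
    rw [Matrix.mul_add, Matrix.add_mul, Matrix.mul_assoc S1,
      Matrix.nonsing_inv_mul_cancel_left _ _ h1]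
  rw [hT, Matrix.mul_assoc (S1⁻¹ + S2⁻¹)⁻¹, hK, Matrix.nonsing_inv_mul_cancel_left _ _ hP,
    Matrix.mul_nonsing_inv_cancel_left _ _ h1]
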